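/- Let n ≥ 3 and let 𝔤 be a 2n-dimensional real 2-step nilpotent Lie algebra with complex structure J admitting a basis α₁,…,α_n of (𝔤^{1,0})* with dα_i = 0 for 1 ≤ i ≤ n−1 and dα_n = Σ_{r=1}^{n−1} c_r α_r ∧ ᾱ_r, where c_r are real numbers with c_r > 0 for 1 ≤ r ≤ n−2, c_{n−1} < 0, and Σ_{r=1}^{n−1} c_r ≠ 0. Then: (a) the positive (1,1)-form ω₁ = i Σ_{i=1}^n α_i ∧ ᾱ_i satisfies d(ω₁^{n−1}) = θ ∧ ω₁^{n−1} with θ = (Σ_{r=1}^{n−1} c_r)(α_n + ᾱ_n), which is closed and nonzero (ω₁ is locally conformally balanced but not balanced); and (b) for any real a₁,…,a_{n−2}, a_n > 0 and a_{n−1} = −(Σ_{r=1}^{n−2} a_r c_r)/c_{n−1} > 0, the (n−1,n−1)-form ω̃ = i^{n−1} Σ_{i=1}^n a_i m_{i ī} is positive and closed, so 𝔤 also carries a balanced metric. -/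

import Mathlib

open scoped BigOperators

/-- The strictly increasing enumeration of `Fin N` avoiding the two indices `a < b`. -/
def skipTwo {N : ℕ} (a b : ℕ) (t : Fin (N - 2)) : Fin N :=
  ⟨if (t : ℕ) < a then (t : ℕ) else if (t : ℕ) + 1 < b then (t : ℕ) + 1 else (t : ℕ) + 2,
    by have := t.isLt; split_ifs <;> omega⟩

/-- The Chevalley–Eilenberg differential of a (raw) `p`-form on a Lie algebra. -/
noncomputable def ceD {g : Type} [LieRing g] [LieAlgebra ℝ g] {p : ℕ}
    (η : (Fin p → g) → ℂ) : (Fin (p + 1) → g) → ℂ :=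
  fun X => ∑ i : Fin (p + 1), ∑ j : Fin (p + 1),
    if hij : (i : ℕ) < (j : ℕ) then
      (-1 : ℂ) ^ ((i : ℕ) + (j : ℕ)) *
        η (fun t => if ht : (t : ℕ) = 0 then ⁅X i, X j⁆
            else X (skipTwo (N := p + 1) (i : ℕ) (j : ℕ)
              ⟨(t : ℕ) - 1, by have := t.isLt; omega⟩))
    else 0

/-- The wedge product of a (raw) `p`-form and a (raw) `q`-form. -/
noncomputable def wedge {g : Type} [LieRing g] [LieAlgebra ℝ g] {p q : ℕ}
    (α : (Fin p → g) → ℂ) (β : (Fin q → g) → ℂ) : (Fin (p + q) → g) → ℂ :=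
  fun X => ((p.factorial : ℂ) * (q.factorial : ℂ))⁻¹ *
    ∑ σ : Equiv.Perm (Fin (p + q)),
      ((Equiv.Perm.sign σ : ℤ) : ℂ) *
        α (fun i => X (σ (Fin.castAdd q i))) * β (fun i => X (σ (Fin.natAdd p i)))

/-- The `k`-th wedge power of a (raw) `2`-form. -/
noncomputable def wpow {g : Type} [LieRing g] [LieAlgebra ℝ g]
    (ω : (Fin 2 → g) → ℂ) (k : ℕ) : (Fin (2 * k) → g) → ℂ :=
  fun X => ((2 : ℂ) ^ k)⁻¹ *
    ∑ σ : Equiv.Perm (Fin (2 * k)),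
      ((Equiv.Perm.sign σ : ℤ) : ℂ) *
        ∏ t : Fin k, ω (fun s => X (σ ⟨2 * (t : ℕ) + (s : ℕ),
          by have := t.isLt; have := s.isLt; omega⟩))

/-- The action of (the linear extension of) `J` on (raw) `p`-forms:
`(Jη)(X₁, …, X_p) = (−1)^p η(JX₁, …, JX_p)`. -/
noncomputable def Jact {g : Type} [LieRing g] [LieAlgebra ℝ g] (J : g →ₗ[ℝ] g) {p : ℕ}
    (η : (Fin p → g) → ℂ) : (Fin p → g) → ℂ :=
  fun X => (-1 : ℂ) ^ p * η (fun i => J (X i))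

/-- The operator `dᶜ = −J⁻¹ d J` on (raw) `p`-forms, where `J⁻¹ = (−1)^p J` on `p`-forms. -/
noncomputable def dcD {g : Type} [LieRing g] [LieAlgebra ℝ g] (J : g →ₗ[ℝ] g) {p : ℕ}
    (η : (Fin p → g) → ℂ) : (Fin (p + 1) → g) → ℂ :=
  fun X => (-1 : ℂ) ^ p * Jact J (ceD (Jact J η)) X

/-- A linear functional viewed as a raw `1`-form. -/
def oneF {g : Type} [LieRing g] [LieAlgebra ℝ g] (f : g → ℂ) : (Fin 1 → g) → ℂ :=
  fun X => f (X 0)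

/-- Reindexing a raw `a`-form as a `b`-form along a proof `a = b`. -/
def reind {g : Type} [LieRing g] [LieAlgebra ℝ g] {a b : ℕ} (h : a = b)
    (η : (Fin a → g) → ℂ) : (Fin b → g) → ℂ :=
  fun X => η (fun i => X (Fin.cast h i))

/-- The wedge product of a family of `p` raw `1`-forms. -/
noncomputable def wedgeList {g : Type} [LieRing g] [LieAlgebra ℝ g] {p : ℕ}
    (f : Fin p → g → ℂ) : (Fin p → g) → ℂ :=
  fun X => ∑ σ : Equiv.Perm (Fin p), ((Equiv.Perm.sign σ : ℤ) : ℂ) * ∏ t, f t (X (σ t))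

/-- The full coframe `α₁, ᾱ₁, …, α_n, ᾱ_n` as a list of `2n` raw `1`-forms. -/
noncomputable def coframeList {g : Type} [LieRing g] [LieAlgebra ℝ g] (n : ℕ)
    (α : Fin n → (g →ₗ[ℝ] ℂ)) : Fin (2 * n) → g → ℂ :=
  fun t x =>
    if (t : ℕ) % 2 = 0 then α ⟨(t : ℕ) / 2, by have := t.isLt; omega⟩ x
    else (starRingEnd ℂ) (α ⟨(t : ℕ) / 2, by have := t.isLt; omega⟩ x)

/-- The `(n−1, n−1)`-form `m_{i j̄}`: the wedge `α₁ ∧ ᾱ₁ ∧ … ∧ α_n ∧ ᾱ_n` with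
`α_i` and `ᾱ_j` deleted. -/
noncomputable def mForm {g : Type} [LieRing g] [LieAlgebra ℝ g] (n : ℕ)
    (α : Fin n → (g →ₗ[ℝ] ℂ)) (i j : Fin n) : (Fin (2 * n - 2) → g) → ℂ :=
  fun X => wedgeList (fun t =>
    coframeList n α
      (if 2 * (i : ℕ) < 2 * (j : ℕ) + 1
        then skipTwo (N := 2 * n) (2 * (i : ℕ)) (2 * (j : ℕ) + 1) t
        else skipTwo (N := 2 * n) (2 * (j : ℕ) + 1) (2 * (i : ℕ)) t)) X

section ExteriorForms

variable {g : Type} [LieRing g] [LieAlgebra ℝ g]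

/-- Complex-valued real-linear functionals, i.e. complex `1`-forms. -/
abbrev CForm (g : Type) [LieRing g] [LieAlgebra ℝ g] : Type := g →ₗ[ℝ] ℂ

/-- Evaluation of complex `1`-forms at a vector. -/
noncomputable def evalAt : g →ₗ[ℝ] Module.Dual ℂ (CForm g) where
  toFun X := { toFun := fun f => f X, map_add' := fun _ _ => rfl, map_smul' := fun _ _ => rfl }
  map_add' X Y := by ext f; simp
  map_smul' t X := by ext f; simp

@[simp] theorem evalAt_apply (X : g) (f : CForm g) : evalAt X f = f X := rfl

/-- Interior product with a vector on the exterior algebra of complex `1`-forms. -/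
noncomputable def innerProd (X : g) :
    ExteriorAlgebra ℂ (CForm g) →ₗ[ℂ] ExteriorAlgebra ℂ (CForm g) :=
  CliffordAlgebra.contractLeft (evalAt X)

theorem innerProd_ι_mul (X : g) (f : CForm g) (y : ExteriorAlgebra ℂ (CForm g)) :
    innerProd X (ExteriorAlgebra.ι ℂ f * y) = f X • y - ExteriorAlgebra.ι ℂ f * innerProd X y :=
  CliffordAlgebra.contractLeft_ι_mul _ _ _

theorem innerProd_one (X : g) : innerProd X 1 = 0 := CliffordAlgebra.contractLeft_one _ _

theorem innerProd_ι (X : g) (f : CForm g) :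
    innerProd X (ExteriorAlgebra.ι ℂ f) = algebraMap ℂ _ (f X) :=
  CliffordAlgebra.contractLeft_ι _ _ f

theorem innerProd_comm (X Y : g) (x : ExteriorAlgebra ℂ (CForm g)) :
    innerProd X (innerProd Y x) = -innerProd Y (innerProd X x) :=
  CliffordAlgebra.contractLeft_comm _ _ _

theorem innerProd_smul (t : ℝ) (X : g) (x : ExteriorAlgebra ℂ (CForm g)) :
    innerProd (t • X) x = (t : ℂ) • innerProd X x := by
  have h : evalAt (t • X) = (t : ℂ) • evalAt X := by ext f; simp
  rw [innerProd, h, map_smul]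
  rfl

/-- The `p`-form attached to an element of the exterior algebra, by iterated interior products. -/
noncomputable def ev : (p : ℕ) → (Fin p → g) → ExteriorAlgebra ℂ (CForm g) →ₗ[ℂ] ℂ
  | 0, _ => ExteriorAlgebra.algebraMapInv.toLinearMap
  | p + 1, X => ev p (Fin.tail X) ∘ₗ innerProd (X 0)

theorem ev_zero (X : Fin 0 → g) (x : ExteriorAlgebra ℂ (CForm g)) :
    ev 0 X x = ExteriorAlgebra.algebraMapInv x := rfl

theorem ev_succ {p : ℕ} (X : Fin (p + 1) → g) (x : ExteriorAlgebra ℂ (CForm g)) :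
    ev (p + 1) X x = ev p (Fin.tail X) (innerProd (X 0) x) := rfl

theorem algebraMapInv_ι (f : CForm g) :
    ExteriorAlgebra.algebraMapInv (ExteriorAlgebra.ι ℂ f) = 0 := by
  simp [ExteriorAlgebra.algebraMapInv]

/-- Laplace expansion of a product with a `1`-form. -/
theorem ev_ι_mul {p : ℕ} (f : CForm g) (y : ExteriorAlgebra ℂ (CForm g)) (X : Fin (p + 1) → g) :
    ev (p + 1) X (ExteriorAlgebra.ι ℂ f * y) =
      ∑ i : Fin (p + 1), (-1 : ℂ) ^ (i : ℕ) * f (X i) * ev p (fun k => X (i.succAbove k)) y := by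
  induction p generalizing y with
  | zero =>
    rw [ev_succ, innerProd_ι_mul, ev_zero, map_sub, map_mul, algebraMapInv_ι]
    simp [ev_zero]
  | succ p ih =>
    rw [ev_succ, innerProd_ι_mul, map_sub, map_smul, ih, Fin.sum_univ_succ (n := p + 1),
      sub_eq_add_neg, ← Finset.sum_neg_distrib]
    congr 1
    · simp [Fin.tail_def]
    · refine Finset.sum_congr rfl fun i _ => ?_
      rw [ev_succ]
      simp only [Fin.tail_def, Fin.val_succ, pow_succ, Fin.succ_succAbove_zero,
        Fin.succ_succAbove_succ]
      ring

theorem ev_prod_ofFn {p : ℕ} (f : Fin p → CForm g) (X : Fin p → g) :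
    ev p X (List.ofFn fun t => ExteriorAlgebra.ι ℂ (f t)).prod =
      wedgeList (fun t x => f t x) X := by
  have hdet (q : ℕ) (f : Fin q → CForm g) (X : Fin q → g) :
      wedgeList (fun t x => f t x) X = Matrix.det (Matrix.of fun t j => f t (X j)) := by
    rw [← Matrix.det_transpose, Matrix.det_apply']
    rfl
  rw [hdet]
  induction p with
  | zero => simp [ev_zero]
  | succ p ih =>
    rw [List.ofFn_succ, List.prod_cons, ev_ι_mul, Matrix.det_succ_row_zero]
    refine Finset.sum_congr rfl fun i _ => ?_
    rw [ih]
    rfl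

theorem skipTwo_zero_succ {p : ℕ} (k : Fin (p + 1)) (t : ℕ) (ht : t < p) :
    skipTwo (N := p + 2) 0 (k + 1) ⟨t, ht⟩ = (k.succAbove ⟨t, ht⟩).succ := by
  ext
  simp only [skipTwo, Fin.succAbove, Fin.lt_def, Fin.val_castSucc]
  split_ifs <;> simp_all

/-- The splitting of the Chevalley–Eilenberg differential along the first argument. -/
theorem ceD_succ {p : ℕ} (η : (Fin (p + 1) → g) → ℂ) (X : Fin (p + 2) → g) :
    ceD η X = ∑ k : Fin (p + 1), (-1 : ℂ) ^ ((k : ℕ) + 1) *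
        η (Fin.cons ⁅X 0, X k.succ⁆ fun t => X (k.succAbove t).succ) +
      ∑ i : Fin (p + 1), ∑ j : Fin (p + 1), if (i : ℕ) < j then
        (-1 : ℂ) ^ ((i : ℕ) + j) * η (fun t => if ht : (t : ℕ) = 0 then ⁅X i.succ, X j.succ⁆
          else X (skipTwo (N := p + 2) (i + 1) (j + 1) ⟨(t : ℕ) - 1, by have := t.isLt; omega⟩))
      else 0 := by
  rw [ceD, Fin.sum_univ_succ]
  congr 1
  · rw [Fin.sum_univ_succ]
    simp only [Fin.val_zero, lt_irrefl, dite_false, zero_add, Fin.val_succ, Nat.succ_pos, dite_true]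
    refine Finset.sum_congr rfl fun k _ => ?_
    congr 2
    ext t
    refine Fin.cases ?_ (fun t => ?_) t
    · simp
    · simp only [Fin.val_succ, Nat.succ_ne_zero, dite_false, Fin.cons_succ]
      congr 1
      exact skipTwo_zero_succ k t t.isLt
  · refine Finset.sum_congr rfl fun i _ => ?_
    rw [Fin.sum_univ_succ, dif_neg (by simp), zero_add]
    simp only [Fin.val_succ, Nat.add_lt_add_iff_right]
    refine Finset.sum_congr rfl fun j _ => ?_
    split_ifs
    · congr 1
      ring
    · rfl

/-- If all brackets are multiples of one vector `w`, the Chevalley–Eilenberg differential is the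
product of a `2`-form with the interior product with `w`. -/
theorem ceD_ev (w : g) (C : ExteriorAlgebra ℂ (CForm g)) (t : g → g → ℝ) (c : g → CForm g)
    (hbr : ∀ X Y : g, ⁅X, Y⁆ = t X Y • w) (hC0 : ExteriorAlgebra.algebraMapInv C = 0)
    (hC : ∀ X y, innerProd X (C * y) = ExteriorAlgebra.ι ℂ (c X) * y + C * innerProd X y)
    (hc : ∀ X Y, c X Y = -(t X Y : ℂ)) {p : ℕ} (x : ExteriorAlgebra ℂ (CForm g)) :
    ceD (fun X => ev p X x) = fun X => ev (p + 1) X (C * innerProd w x) := by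
  induction p generalizing x with
  | zero =>
    funext X
    rw [ev_succ, hC, ev_zero, map_add, map_mul, map_mul, algebraMapInv_ι, hC0]
    simp [ceD]
  | succ p ih =>
    funext X
    rw [ceD_succ, ev_succ, hC, map_add, ev_ι_mul]
    congr 1
    · refine Finset.sum_congr rfl fun k _ => ?_
      rw [ev_succ, hbr, Fin.cons_zero, innerProd_smul, map_smul, hc, Fin.tail_cons]
      simp only [Fin.tail_def, smul_eq_mul, pow_succ]
      ring
    · have h := congrFun (ih (innerProd (X 0) x)) (Fin.tail X)
      rw [innerProd_comm (X 0) w, mul_neg, map_neg, ← h, ceD, ← Finset.sum_neg_distrib]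
      refine Finset.sum_congr rfl fun i _ => ?_
      rw [← Finset.sum_neg_distrib]
      refine Finset.sum_congr rfl fun j _ => ?_
      split_ifs with hij
      · cases p with
        | zero => omega
        | succ p =>
          simp only [ev_succ]
          rw [← mul_neg, ← map_neg, ← innerProd_comm]
          congr 3
          · funext s
            simp only [Fin.tail_def, Fin.val_succ, Nat.succ_ne_zero, dite_false]
            congr 1
            ext
            simp only [skipTwo, Fin.val_succ]
            split_ifs <;> omega
      · simp

theorem wedge_oneF_ofFn {q : ℕ} (u : CForm g) (f : Fin q → CForm g) (h : 1 + q = q + 1)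
    (X : Fin (q + 1) → g) :
    wedge (oneF fun x => u x)
        (fun Y => ev q Y (List.ofFn fun t => ExteriorAlgebra.ι ℂ (f t)).prod)
        (fun i => X (Fin.cast h i)) =
      ev (q + 1) X (ExteriorAlgebra.ι ℂ u * (List.ofFn fun t => ExteriorAlgebra.ι ℂ (f t)).prod) := by
  have hcons : ExteriorAlgebra.ι ℂ u * (List.ofFn fun t => ExteriorAlgebra.ι ℂ (f t)).prod =
      (List.ofFn fun t => ExteriorAlgebra.ι ℂ ((Fin.cons u f : Fin (q + 1) → CForm g) t)).prod := by
    simp [List.ofFn_succ]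
  rw [hcons, ev_prod_ofFn]
  simp only [wedge, ev_prod_ofFn]
  have hreindex : ∑ σ : Equiv.Perm (Fin (1 + q)), ((Equiv.Perm.sign σ : ℤ) : ℂ) *
        oneF (fun x => u x) (fun i => X (Fin.cast h (σ (Fin.castAdd q i)))) *
        wedgeList (fun t x => f t x) (fun i => X (Fin.cast h (σ (Fin.natAdd 1 i)))) =
      ∑ σ : Equiv.Perm (Fin (q + 1)), ∑ τ : Equiv.Perm (Fin q), ((Equiv.Perm.sign σ : ℤ) : ℂ) *
        ((Equiv.Perm.sign τ : ℤ) : ℂ) * (u (X (σ 0)) * ∏ t, f t (X (σ (τ t).succ))) := by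
    rw [← Equiv.sum_comp (finCongr h).permCongr]
    refine Finset.sum_congr rfl fun σ _ => ?_
    rw [Equiv.Perm.sign_permCongr, wedgeList, Finset.mul_sum]
    refine Finset.sum_congr rfl fun τ _ => ?_
    have h0 : (finCongr h).symm 0 = Fin.castAdd q 0 := by ext; simp
    have hs (t : Fin q) : (finCongr h).symm t.succ = Fin.natAdd 1 t := by ext; simp [add_comm]
    simp only [oneF, Equiv.permCongr_apply, h0, hs, finCongr_apply]
    ring
  rw [hreindex, Finset.sum_comm]
  have hτ (τ : Equiv.Perm (Fin q)) :
      ∑ σ : Equiv.Perm (Fin (q + 1)), ((Equiv.Perm.sign σ : ℤ) : ℂ) *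
        ((Equiv.Perm.sign τ : ℤ) : ℂ) * (u (X (σ 0)) * ∏ t, f t (X (σ (τ t).succ))) =
      wedgeList (fun t x => (Fin.cons u f : Fin (q + 1) → CForm g) t x) X := by
    rw [wedgeList, eq_comm, ← Equiv.sum_comp (Equiv.mulRight (Equiv.Perm.decomposeFin.symm (0, τ)))]
    refine Finset.sum_congr rfl fun σ _ => ?_
    rw [Fin.prod_univ_succ]
    simp [Equiv.Perm.decomposeFin.symm_sign]
  simp only [hτ]
  have : (q.factorial : ℂ) ≠ 0 := by exact_mod_cast q.factorial_ne_zero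
  simp [Fintype.card_perm, this]

/-- The wedge of the members of a pair of `1`-forms, in the exterior algebra. -/
noncomputable def pairForm {ι : Type*} (F : ι → Fin 2 → CForm g) (i : ι) :
    ExteriorAlgebra ℂ (CForm g) :=
  ExteriorAlgebra.ι ℂ (F i 0) * ExteriorAlgebra.ι ℂ (F i 1)

/-- The concatenation of `k` pairs of `1`-forms. -/
def flatPairs {k : ℕ} (F : Fin k → Fin 2 → CForm g) (j : Fin (2 * k)) : CForm g :=
  F ⟨j / 2, by omega⟩ ⟨j % 2, by omega⟩

theorem prod_ofFn_pairForm {k : ℕ} (F : Fin k → Fin 2 → CForm g) :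
    (List.ofFn (pairForm F)).prod =
      (List.ofFn fun j => ExteriorAlgebra.ι ℂ (flatPairs F j)).prod := by
  rw [List.ofFn_mul', List.prod_flatten, List.map_ofFn]
  congr 2
  funext t
  have h1 : (2 * (t : ℕ) + 1) / 2 = t := by omega
  simp [pairForm, flatPairs, h1]

theorem sum_sign_prod_wedge {k : ℕ} (F : Fin k → Fin 2 → CForm g) (X : Fin (2 * k) → g) :
    ∑ σ : Equiv.Perm (Fin (2 * k)), ((Equiv.Perm.sign σ : ℤ) : ℂ) *
        ∏ t : Fin k, wedge (oneF fun x => F t 0 x) (oneF fun x => F t 1 x)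
          (fun s : Fin 2 => X (σ ⟨2 * (t : ℕ) + (s : ℕ), by omega⟩)) =
      2 ^ k * wedgeList (fun j x => flatPairs F j x) X := by
  have hw (t : Fin k) (Y : Fin 2 → g) :
      wedge (oneF fun x => F t 0 x) (oneF fun x => F t 1 x) Y =
        ∑ ρ : Equiv.Perm (Fin 2), ((Equiv.Perm.sign ρ : ℤ) : ℂ) * ∏ s, F t s (Y (ρ s)) := by
    simp only [wedge, Nat.factorial_one, Nat.cast_one, mul_one, inv_one, one_mul, oneF,
      Fin.prod_univ_two, mul_assoc]
    rfl
  let e : Fin k × Fin 2 ≃ Fin (2 * k) := finProdFinEquiv.trans (finCongr (mul_comm k 2))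
  have he (t : Fin k) (s : Fin 2) : e (t, s) = ⟨2 * (t : ℕ) + (s : ℕ), by omega⟩ := by
    ext; simp [e, add_comm]
  have hflat (t : Fin k) (s : Fin 2) : flatPairs F (e (t, s)) = F t s := by
    have h0 : (2 * (t : ℕ) + s) / 2 = t := by omega
    have h1 : (2 * (t : ℕ) + s) % 2 = s := by omega
    simp [he, flatPairs, h0, h1]
  simp only [hw, ← he, Fintype.prod_sum, Finset.mul_sum]
  rw [Finset.sum_comm]
  have hρ (ρ : Fin k → Equiv.Perm (Fin 2)) :
      ∑ σ : Equiv.Perm (Fin (2 * k)), ((Equiv.Perm.sign σ : ℤ) : ℂ) *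
        ∏ t, (((Equiv.Perm.sign (ρ t) : ℤ) : ℂ) * ∏ s, F t s (X (σ (e (t, ρ t s))))) =
      wedgeList (fun j x => flatPairs F j x) X := by
    rw [wedgeList, eq_comm, ← Equiv.sum_comp (Equiv.mulRight (e.permCongr (Equiv.prodCongrRight ρ)))]
    refine Finset.sum_congr rfl fun σ _ => ?_
    rw [← Equiv.prod_comp e, Fintype.prod_prod_type, Finset.prod_mul_distrib, ← mul_assoc]
    congr 1
    · simp [Equiv.Perm.sign_mul, Equiv.Perm.sign_prodCongrRight]
    · simp [hflat]
  simp only [hρ]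
  simp [Fintype.card_perm]

theorem pow_sum_pairForm {ι : Type*} [Fintype ι] (F : ι → Fin 2 → CForm g) (k : ℕ) :
    (∑ i, pairForm F i) ^ k =
      ∑ φ : Fin k → ι, (List.ofFn (pairForm fun t => F (φ t))).prod := by
  classical
  have h := (MultilinearMap.mkPiAlgebraFin ℂ k (ExteriorAlgebra ℂ (CForm g))).map_sum
    (fun _ i => pairForm F i)
  rw [MultilinearMap.mkPiAlgebraFin_apply_const] at h
  exact h

theorem wpow_eq_ev {ι : Type*} [Fintype ι] (F : ι → Fin 2 → CForm g) (k : ℕ) :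
    wpow (fun v => Complex.I *
        ∑ i, wedge (oneF fun x => F i 0 x) (oneF fun x => F i 1 x) v) k =
      fun X => ev (2 * k) X ((Complex.I • ∑ i, pairForm F i) ^ k) := by
  classical
  funext X
  rw [smul_pow, map_smul, pow_sum_pairForm, map_sum, wpow]
  simp only [prod_ofFn_pairForm, ev_prod_ofFn, Finset.prod_mul_distrib, Finset.prod_const,
    Finset.card_univ, Fintype.card_fin, Fintype.prod_sum, Finset.mul_sum]
  rw [Finset.sum_comm, Finset.smul_sum]
  refine Finset.sum_congr rfl fun φ _ => ?_
  have h := sum_sign_prod_wedge (fun t => F (φ t)) X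
  rw [← Finset.mul_sum, smul_eq_mul]
  rw [eq_comm, ← inv_mul_cancel_left₀ (pow_ne_zero k (two_ne_zero' ℂ))
    (wedgeList (fun j x => flatPairs (fun t => F (φ t)) j x) X), ← h, Finset.mul_sum,
    Finset.mul_sum, Finset.mul_sum]
  refine Finset.sum_congr rfl fun σ _ => ?_
  ring

theorem wedge_oneF_pow {ι : Type*} [Fintype ι] (u : CForm g) (F : ι → Fin 2 → CForm g) (k : ℕ)
    (a : ℂ) (h : 1 + 2 * k = 2 * k + 1) :
    reind h (wedge (oneF fun x => u x) (fun X => ev (2 * k) X ((a • ∑ i, pairForm F i) ^ k))) =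
      fun X => ev (2 * k + 1) X (ExteriorAlgebra.ι ℂ u * (a • ∑ i, pairForm F i) ^ k) := by
  funext X
  have hlin (φ : Fin k → ι) := wedge_oneF_ofFn u (flatPairs fun t => F (φ t)) h X
  rw [smul_pow, mul_smul_comm, pow_sum_pairForm, Finset.mul_sum, map_smul, map_sum]
  simp only [prod_ofFn_pairForm, ← hlin, reind, wedge, map_smul, map_sum, smul_eq_mul,
    Finset.mul_sum]
  rw [Finset.sum_comm]
  refine Finset.sum_congr rfl fun φ _ => Finset.sum_congr rfl fun σ _ => ?_
  ring

theorem mForm_eq_ev {m : ℕ} (α : Fin (m + 1) → CForm g) (F : Fin (m + 1) → Fin 2 → CForm g)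
    (hF0 : ∀ i, F i 0 = α i) (hF1 : ∀ i x, F i 1 x = (starRingEnd ℂ) (α i x)) (i : Fin (m + 1))
    (X : Fin (2 * m) → g) :
    mForm (m + 1) α i i X =
      ev (2 * m) X (List.ofFn fun t : Fin m => pairForm F (i.succAbove t)).prod := by
  have h : (fun t : Fin m => pairForm F (i.succAbove t)) =
      pairForm fun t => F (i.succAbove t) := rfl
  rw [h, prod_ofFn_pairForm, ev_prod_ofFn, mForm]
  simp only [lt_add_one, if_true]
  refine congrArg (fun f => wedgeList f X) ?_
  funext t x
  have hdiv : ((skipTwo (N := 2 * (m + 1)) (2 * (i : ℕ)) (2 * (i : ℕ) + 1) t : Fin _) : ℕ) / 2 =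
      (i.succAbove ⟨t / 2, by omega⟩ : Fin (m + 1)) := by
    simp only [skipTwo, Fin.succAbove, Fin.lt_def, Fin.val_castSucc]
    split_ifs <;> simp <;> omega
  have hmod : ((skipTwo (N := 2 * (m + 1)) (2 * (i : ℕ)) (2 * (i : ℕ) + 1) t : Fin _) : ℕ) % 2 =
      (t : ℕ) % 2 := by
    simp only [skipTwo]
    split_ifs <;> omega
  simp only [coframeList, flatPairs, hdiv, hmod]
  rcases Nat.mod_two_eq_zero_or_one (t : ℕ) with h0 | h0
  · simp [h0, hF0]
  · simp [h0, hF1]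

theorem innerProd_pairForm_mul {ι : Type*} (X : g) (F : ι → Fin 2 → CForm g) (i : ι)
    (y : ExteriorAlgebra ℂ (CForm g)) :
    innerProd X (pairForm F i * y) =
      innerProd X (pairForm F i) * y + pairForm F i * innerProd X y := by
  simp only [pairForm, mul_assoc, innerProd_ι_mul, innerProd_ι, mul_sub, sub_mul, smul_mul_assoc,
    mul_smul_comm, Algebra.algebraMap_eq_smul_one, mul_one]
  abel

theorem innerProd_pairForm {ι : Type*} (X : g) (F : ι → Fin 2 → CForm g) (i : ι) :
    innerProd X (pairForm F i) =
      ExteriorAlgebra.ι ℂ (F i 0 X • F i 1 - F i 1 X • F i 0) := by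
  simp only [pairForm, innerProd_ι_mul, innerProd_ι, mul_smul_comm, map_sub, map_smul,
    Algebra.algebraMap_eq_smul_one, mul_one]

theorem pairForm_mem_center {ι : Type*} (F : ι → Fin 2 → CForm g) (i : ι) :
    pairForm F i ∈ Subalgebra.center ℂ (ExteriorAlgebra ℂ (CForm g)) := by
  have hswap (u v : CForm g) : ExteriorAlgebra.ι ℂ u * ExteriorAlgebra.ι ℂ v =
      -(ExteriorAlgebra.ι ℂ v * ExteriorAlgebra.ι ℂ u) :=
    eq_neg_of_add_eq_zero_left (ExteriorAlgebra.ι_add_mul_swap u v)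
  rw [Subalgebra.mem_center_iff]
  intro b
  induction b using ExteriorAlgebra.induction with
  | algebraMap r => exact Algebra.commutes r _
  | ι x =>
    rw [pairForm, ← mul_assoc, hswap x, neg_mul, mul_assoc, hswap x, mul_neg, neg_neg, mul_assoc]
  | mul a b ha hb => rw [mul_assoc, hb, ← mul_assoc, ha, mul_assoc]
  | add a b ha hb => rw [add_mul, mul_add, ha, hb]

/-- `pairForm` as a member of the commutative ring of central elements. -/
noncomputable def centralPair {ι : Type*} (F : ι → Fin 2 → CForm g) (i : ι) :
    Subalgebra.center ℂ (ExteriorAlgebra ℂ (CForm g)) :=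
  ⟨pairForm F i, pairForm_mem_center F i⟩

theorem pairForm_mul_ι_left {ι : Type*} (F : ι → Fin 2 → CForm g) (i : ι) :
    pairForm F i * ExteriorAlgebra.ι ℂ (F i 0) = 0 := by
  rw [← Subalgebra.mem_center_iff.mp (pairForm_mem_center F i), pairForm, ← mul_assoc,
    ExteriorAlgebra.ι_sq_zero, zero_mul]

theorem pairForm_mul_ι_right {ι : Type*} (F : ι → Fin 2 → CForm g) (i : ι) :
    pairForm F i * ExteriorAlgebra.ι ℂ (F i 1) = 0 := by
  rw [pairForm, mul_assoc, ExteriorAlgebra.ι_sq_zero, mul_zero]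

theorem centralPair_mul_self {ι : Type*} (F : ι → Fin 2 → CForm g) (i : ι) :
    centralPair F i * centralPair F i = 0 := by
  ext
  change pairForm F i * (ExteriorAlgebra.ι ℂ (F i 0) * ExteriorAlgebra.ι ℂ (F i 1)) = 0
  rw [← mul_assoc, pairForm_mul_ι_left, zero_mul]

section SquareZero

variable {R : Type*} [CommRing R]

theorem add_pow_succ_of_mul_self_eq_zero {z : R} (hz : z * z = 0) (s : R) (k : ℕ) :
    (z + s) ^ (k + 1) = s ^ (k + 1) + (k + 1) * z * s ^ k := by
  induction k with
  | zero => simp [add_comm]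
  | succ k ih =>
    rw [pow_succ, ih]
    push_cast
    linear_combination ((k : R) + 1) * s ^ k * hz

theorem sum_pow_card_succ_eq_zero {ι : Type*} (z : ι → R) (hz : ∀ i, z i * z i = 0)
    (T : Finset ι) : (∑ i ∈ T, z i) ^ (T.card + 1) = 0 := by
  classical
  induction T using Finset.induction_on with
  | empty => simp
  | insert a T ha ih =>
    rw [Finset.sum_insert ha, Finset.card_insert_of_notMem ha,
      add_pow_succ_of_mul_self_eq_zero (hz a), pow_succ, ih]
    ring

theorem mul_sum_pow_eq {k : ℕ} (z : Fin (k + 1) → R) (hz : ∀ i, z i * z i = 0)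
    (r : Fin (k + 1)) : (k + 1) * (z r * (∑ i, z i) ^ k) = (∑ i, z i) ^ (k + 1) := by
  classical
  have hs : (∑ i ∈ Finset.univ.erase r, z i) ^ (k + 1) = 0 := by
    simpa using sum_pow_card_succ_eq_zero z hz (Finset.univ.erase r)
  rw [← Finset.add_sum_erase _ _ (Finset.mem_univ r),
    add_pow_succ_of_mul_self_eq_zero (hz r), hs]
  cases k with
  | zero => simp
  | succ k =>
    rw [add_pow_succ_of_mul_self_eq_zero (hz r)]
    linear_combination ((k + 1 : ℕ) + 1 : R) * (k + 1) *
      (∑ i ∈ Finset.univ.erase r, z i) ^ k * hz r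

theorem mul_prod_ite_eq {ι : Type*} [Fintype ι] [DecidableEq ι] (z : ι → R)
    (hz : ∀ i, z i * z i = 0) (s r : ι) :
    z s * ∏ i, (if i = r then 1 else z i) = if s = r then ∏ i, z i else 0 := by
  split_ifs with h
  · subst h
    have hprod : z s = ∏ i, if i = s then z i else 1 := by simp
    conv_lhs => rw [hprod]
    rw [← Finset.prod_mul_distrib]
    refine Finset.prod_congr rfl fun i _ => ?_
    split_ifs <;> simp
  · rw [← Finset.mul_prod_erase _ _ (Finset.mem_univ s), if_neg h, ← mul_assoc, hz, zero_mul]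

theorem prod_succAbove_eq {m : ℕ} (z : Fin (m + 1) → R) (i : Fin (m + 1)) :
    ∏ t, z (i.succAbove t) = ∏ j, if j = i then 1 else z j := by
  rw [Fin.prod_univ_succAbove _ i]
  simp

end SquareZero

theorem coe_prod_centralPair {m : ℕ} (F : Fin (m + 1) → Fin 2 → CForm g) (i : Fin (m + 1)) :
    (List.ofFn fun t : Fin m => pairForm F (i.succAbove t)).prod =
      ((∏ t, centralPair F (i.succAbove t) :
        Subalgebra.center ℂ (ExteriorAlgebra ℂ (CForm g))) :
          ExteriorAlgebra ℂ (CForm g)) := by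
  rw [← List.prod_ofFn]
  change _ = (Subalgebra.center ℂ (ExteriorAlgebra ℂ (CForm g))).val _
  rw [map_list_prod, List.map_ofFn]
  rfl

/-- Interior products with `X` are even derivations on products of pairs annihilated by `X`. -/
theorem innerProd_prod_centralPair_mul {ι : Type*} (X : g) (F : ι → Fin 2 → CForm g)
    (T : Finset ι) (hT : ∀ i ∈ T, innerProd X (pairForm F i) = 0)
    (y : ExteriorAlgebra ℂ (CForm g)) :
    innerProd X (((∏ i ∈ T, centralPair F i :
        Subalgebra.center ℂ (ExteriorAlgebra ℂ (CForm g))) : ExteriorAlgebra ℂ (CForm g)) * y) =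
      ((∏ i ∈ T, centralPair F i : Subalgebra.center ℂ (ExteriorAlgebra ℂ (CForm g))) :
        ExteriorAlgebra ℂ (CForm g)) * innerProd X y := by
  classical
  induction T using Finset.induction_on generalizing y with
  | empty => simp
  | insert a T ha ih =>
    rw [Finset.prod_insert ha, Subalgebra.coe_mul, mul_assoc, mul_assoc]
    change innerProd X (pairForm F a * _) = pairForm F a * _
    rw [innerProd_pairForm_mul, hT a (Finset.mem_insert_self a T), zero_mul, zero_add,
      ih fun i hi => hT i (Finset.mem_insert_of_mem hi)]

theorem innerProd_pow (X : g)
    (S : Subalgebra.center ℂ (ExteriorAlgebra ℂ (CForm g)))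
    (hS : ∀ y, innerProd X (S * y) = innerProd X S * y + S * innerProd X y) (k : ℕ) :
    innerProd X ((S : ExteriorAlgebra ℂ (CForm g)) ^ (k + 1)) =
      ((k : ℂ) + 1) • ((S : ExteriorAlgebra ℂ (CForm g)) ^ k * innerProd X S) := by
  induction k with
  | zero => simp
  | succ k ih =>
    have hcomm (y : ExteriorAlgebra ℂ (CForm g)) : y * (S : ExteriorAlgebra ℂ (CForm g)) ^ (k + 1) =
        (S : ExteriorAlgebra ℂ (CForm g)) ^ (k + 1) * y :=
      Subalgebra.mem_center_iff.mp (pow_mem S.2 (k + 1)) y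
    rw [pow_succ' _ (k + 1), hS, ih, hcomm, mul_smul_comm, ← mul_assoc, ← pow_succ']
    push_cast
    module

/-- The `2`-form `-i ∑ c_r F_{r,0} ∧ F_{r,1}` over all pairs but the last. -/
noncomputable def curvForm {m : ℕ} (c : Fin m → ℝ) (F : Fin (m + 1) → Fin 2 → CForm g) :
    ExteriorAlgebra ℂ (CForm g) :=
  (-Complex.I) • ∑ r, (c r : ℂ) • pairForm F r.castSucc

theorem innerProd_curvForm_mul {m : ℕ} (c : Fin m → ℝ) (F : Fin (m + 1) → Fin 2 → CForm g)
    (X : g) (y : ExteriorAlgebra ℂ (CForm g)) :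
    innerProd X (curvForm c F * y) =
      ExteriorAlgebra.ι ℂ ((-Complex.I) • ∑ r, (c r : ℂ) •
        (F r.castSucc 0 X • F r.castSucc 1 - F r.castSucc 1 X • F r.castSucc 0)) * y +
      curvForm c F * innerProd X y := by
  rw [map_smul, map_sum]
  simp only [curvForm, map_smul, smul_mul_assoc, Finset.sum_mul, map_sum, innerProd_pairForm_mul,
    innerProd_pairForm, smul_add, Finset.sum_add_distrib]

theorem algebraMapInv_curvForm {m : ℕ} (c : Fin m → ℝ) (F : Fin (m + 1) → Fin 2 → CForm g) :
    ExteriorAlgebra.algebraMapInv (curvForm c F) = 0 := by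
  simp only [curvForm, pairForm, map_smul, map_sum, map_mul, algebraMapInv_ι, zero_mul, smul_zero,
    Finset.sum_const_zero]

theorem add_pow_mul_of_mul_eq_zero {A : Type*} [Ring A] {s z v : A} (hc : Commute s z)
    (h : z * v = 0) (k : ℕ) : (s + z) ^ k * v = s ^ k * v := by
  induction k with
  | zero => simp
  | succ k ih =>
    have hz : z * (s ^ k * v) = 0 := by
      rw [← mul_assoc, ← (hc.pow_left k).eq, mul_assoc, h, mul_zero]
    rw [pow_succ', mul_assoc, ih, add_mul, hz, add_zero, ← mul_assoc, ← pow_succ']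

theorem innerProd_pairForm_castSucc {m : ℕ} (F : Fin (m + 1) → Fin 2 → CForm g) (w : g)
    (hw : ∀ r : Fin m, ∀ s, F r.castSucc s w = 0) (r : Fin m) :
    innerProd w (pairForm F r.castSucc) = 0 := by
  simp [innerProd_pairForm, hw]

theorem curvForm_mul_innerProd_pow {k : ℕ} (c : Fin (k + 1) → ℝ)
    (F : Fin (k + 2) → Fin 2 → CForm g) (w : g) (hw : ∀ r : Fin (k + 1), ∀ s, F r.castSucc s w = 0)
    (hw0 : F (Fin.last (k + 1)) 0 w = Complex.I) (hw1 : F (Fin.last (k + 1)) 1 w = -Complex.I) :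
    curvForm c F * innerProd w ((Complex.I • ∑ i, pairForm F i) ^ (k + 1)) =
      ExteriorAlgebra.ι ℂ (((∑ r, c r : ℝ) : ℂ) •
          (F (Fin.last (k + 1)) 0 + F (Fin.last (k + 1)) 1)) *
        (Complex.I • ∑ i, pairForm F i) ^ (k + 1) := by
  set η := ExteriorAlgebra.ι ℂ (F (Fin.last (k + 1)) 0 + F (Fin.last (k + 1)) 1) with hη
  let S0 : Subalgebra.center ℂ (ExteriorAlgebra ℂ (CForm g)) :=
    ∑ r : Fin (k + 1), centralPair F r.castSucc
  have hS0 : (S0 : ExteriorAlgebra ℂ (CForm g)) = ∑ r : Fin (k + 1), pairForm F r.castSucc := by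
    simp [S0, centralPair]
  let S : Subalgebra.center ℂ (ExteriorAlgebra ℂ (CForm g)) :=
    Complex.I • ∑ i, centralPair F i
  have hS : (S : ExteriorAlgebra ℂ (CForm g)) = Complex.I • ∑ i, pairForm F i := by
    simp [S, centralPair]
  have hder (y : ExteriorAlgebra ℂ (CForm g)) :
      innerProd w (S * y) = innerProd w S * y + S * innerProd w y := by
    simp only [hS, smul_mul_assoc, Finset.sum_mul, map_smul, map_sum, innerProd_pairForm_mul,
      Finset.sum_add_distrib, smul_add]
  have hwS : innerProd w (S : ExteriorAlgebra ℂ (CForm g)) = -η := by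
    rw [hS, map_smul, map_sum, Fin.sum_univ_castSucc,
      Finset.sum_eq_zero fun r _ => innerProd_pairForm_castSucc F w hw r, zero_add,
      innerProd_pairForm, hw0, hw1, hη, ← map_smul, ← map_neg]
    congr 1
    rw [smul_sub, smul_smul, smul_smul, mul_neg, Complex.I_mul_I]
    module
  have hlast : pairForm F (Fin.last (k + 1)) * η = 0 := by
    rw [hη, map_add, mul_add, pairForm_mul_ι_left, pairForm_mul_ι_right, add_zero]
  have hSη (j : ℕ) : (S : ExteriorAlgebra ℂ (CForm g)) ^ j * η =
      Complex.I ^ j • ((S0 : ExteriorAlgebra ℂ (CForm g)) ^ j * η) := by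
    rw [hS, smul_pow, smul_mul_assoc, Fin.sum_univ_castSucc, ← hS0,
      add_pow_mul_of_mul_eq_zero _ hlast]
    exact Subalgebra.mem_center_iff.mp (pairForm_mem_center F _) _
  have hmain (r : Fin (k + 1)) : ((k : ℂ) + 1) • (pairForm F r.castSucc *
      (S0 : ExteriorAlgebra ℂ (CForm g)) ^ k) = (S0 : ExteriorAlgebra ℂ (CForm g)) ^ (k + 1) := by
    have h := congrArg (Subalgebra.val _) (mul_sum_pow_eq (fun r : Fin (k + 1) =>
      centralPair F r.castSucc) (fun _ => centralPair_mul_self F _) r)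
    have hcast : ((k : ExteriorAlgebra ℂ (CForm g)) + 1) =
        algebraMap ℂ _ ((k : ℂ) + 1) := by simp
    rw [map_mul, map_add, map_natCast, map_one, hcast, ← Algebra.smul_def] at h
    exact h
  rw [← hS, innerProd_pow w S hder, hwS, map_smul, smul_mul_assoc, ← hη,
    Subalgebra.mem_center_iff.mp (pow_mem S.2 (k + 1)) η, hSη, mul_neg, hSη, curvForm]
  rw [smul_mul_assoc, smul_neg, mul_neg, mul_smul_comm, mul_smul_comm, Finset.sum_mul]
  have hterm (r : Fin (k + 1)) : ((k : ℂ) + 1) • ((c r : ℂ) • pairForm F r.castSucc *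
      ((S0 : ExteriorAlgebra ℂ (CForm g)) ^ k * η)) =
      (c r : ℂ) • ((S0 : ExteriorAlgebra ℂ (CForm g)) ^ (k + 1) * η) := by
    rw [← hmain r, smul_mul_assoc, smul_comm, ← mul_assoc, smul_mul_assoc]
  rw [smul_comm ((k : ℂ) + 1), Finset.smul_sum]
  simp only [hterm]
  rw [← Finset.sum_smul, pow_succ]
  push_cast
  module

theorem curvForm_mul_innerProd_sum {m : ℕ} (c : Fin m → ℝ)
    (F : Fin (m + 1) → Fin 2 → CForm g) (w : g) (hw : ∀ r : Fin m, ∀ s, F r.castSucc s w = 0)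
    (a : Fin (m + 1) → ℝ) (ha : ∑ r : Fin m, a r.castSucc * c r = 0) :
    curvForm c F * innerProd w (∑ i, (a i : ℂ) •
      (List.ofFn fun t : Fin m => pairForm F (i.succAbove t)).prod) = 0 := by
  classical
  have hann (r : Fin m) := innerProd_pairForm_castSucc F w hw r
  let P (r : Fin m) : Subalgebra.center ℂ (ExteriorAlgebra ℂ (CForm g)) :=
    ∏ s, if s = r then 1 else centralPair F s.castSucc
  let V : Subalgebra.center ℂ (ExteriorAlgebra ℂ (CForm g)) := ∏ s : Fin m, centralPair F s.castSucc
  have hV : innerProd w (V : ExteriorAlgebra ℂ (CForm g)) = 0 := by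
    have h := innerProd_prod_centralPair_mul w (fun r : Fin m => F r.castSucc) Finset.univ
      (fun r _ => hann r) 1
    rw [mul_one, innerProd_one, mul_zero] at h
    exact h
  have hP (r : Fin m) (y : ExteriorAlgebra ℂ (CForm g)) :
      innerProd w ((P r : ExteriorAlgebra ℂ (CForm g)) * y) = P r * innerProd w y := by
    have h := innerProd_prod_centralPair_mul w (fun r : Fin m => F r.castSucc)
      (Finset.univ.filter fun s => ¬ s = r) (fun r _ => hann r) y
    have hPr : P r = ∏ s ∈ Finset.univ.filter fun s => ¬ s = r,
        centralPair (fun r : Fin m => F r.castSucc) s := by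
      simp only [P, Finset.prod_ite, Finset.prod_const_one, one_mul]
      rfl
    rw [hPr]
    exact h
  have hlast : (List.ofFn fun t : Fin m => pairForm F ((Fin.last m).succAbove t)).prod = V := by
    rw [coe_prod_centralPair]
    simp [V]
  have hcast (r : Fin m) : (List.ofFn fun t : Fin m => pairForm F (r.castSucc.succAbove t)).prod =
      (P r : ExteriorAlgebra ℂ (CForm g)) * pairForm F (Fin.last m) := by
    rw [coe_prod_centralPair, prod_succAbove_eq, Fin.prod_univ_castSucc,
      if_neg (Fin.castSucc_lt_last r).ne']
    simp only [Fin.castSucc_inj]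
    rfl
  have hxP (s r : Fin m) : pairForm F s.castSucc * (P r : ExteriorAlgebra ℂ (CForm g)) =
      if s = r then (V : ExteriorAlgebra ℂ (CForm g)) else 0 := by
    have h := congrArg (Subalgebra.val _) (mul_prod_ite_eq (fun s : Fin m =>
      centralPair F s.castSucc) (fun _ => centralPair_mul_self F _) s r)
    rw [apply_ite (Subalgebra.val _), map_zero] at h
    exact h
  have hcurv (r : Fin m) : curvForm c F * (P r : ExteriorAlgebra ℂ (CForm g)) =
      (-Complex.I * c r) • (V : ExteriorAlgebra ℂ (CForm g)) := by
    simp [curvForm, Finset.sum_mul, hxP, mul_smul]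
  rw [Fin.sum_univ_castSucc, hlast, map_add, map_smul, hV, smul_zero, add_zero, map_sum]
  simp only [hcast, map_smul, hP, Finset.mul_sum, mul_smul_comm, ← mul_assoc, hcurv,
    smul_mul_assoc, smul_smul]
  rw [← Finset.sum_smul]
  have hz : ∑ r : Fin m, (a r.castSucc : ℂ) * -Complex.I * c r = 0 := by
    have h : ∑ r : Fin m, (a r.castSucc : ℂ) * -Complex.I * c r =
        -Complex.I * ((∑ r : Fin m, a r.castSucc * c r : ℝ) : ℂ) := by
      push_cast
      rw [Finset.mul_sum]
      exact Finset.sum_congr rfl fun r _ => by ring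
    rw [h, ha]
    simp
  rw [hz, zero_smul]

/-- The pair consisting of a `1`-form and its conjugate. -/
noncomputable def conjPair {ι : Type*} (α : ι → CForm g) (i : ι) : Fin 2 → CForm g :=
  ![α i, Complex.conjAe.toLinearMap ∘ₗ α i]

@[simp] theorem conjPair_zero {ι : Type*} (α : ι → CForm g) (i : ι) : conjPair α i 0 = α i := rfl

@[simp] theorem conjPair_one_apply {ι : Type*} (α : ι → CForm g) (i : ι) (x : g) :
    conjPair α i 1 x = (starRingEnd ℂ) (α i x) := rfl

theorem ceD_oneF (f : g → ℂ) (X Y : g) : ceD (oneF f) ![X, Y] = -f ⁅X, Y⁆ := by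
  simp [ceD, Fin.sum_univ_two, oneF]

theorem wedge_oneF_oneF (u v : g → ℂ) (X Y : g) :
    wedge (oneF u) (oneF v) ![X, Y] = u X * v Y - u Y * v X := by
  have h := Matrix.det_apply' (Matrix.of fun s t : Fin 2 => ![u, v] t (![X, Y] s))
  rw [Matrix.det_fin_two] at h
  simp only [Matrix.of_apply, Fin.prod_univ_two, Matrix.cons_val_zero, Matrix.cons_val_one] at h
  rw [wedge]
  simp only [Nat.factorial_one, Nat.cast_one, mul_one, inv_one, one_mul, mul_assoc]
  exact h.symm.trans (by ring)

/-- If a coframe satisfies `dα_r = 0` except for `dα_last = ∑ c_r α_r ∧ ᾱ_r`, the differential of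
every form is the product of `curvForm` with an interior product. -/
theorem exists_ceD_ev_eq {m : ℕ} (α : Fin (m + 1) → CForm g) (c : Fin m → ℝ)
    (hbasis : Function.Bijective (fun (x : g) (i : Fin (m + 1)) => α i x))
    (hd1 : ∀ r : Fin m, ceD (oneF fun x => α r.castSucc x) = 0)
    (hd2 : ceD (oneF fun x => α (Fin.last m) x) = fun v => ∑ r : Fin m, (c r : ℂ) *
      wedge (oneF fun x => α r.castSucc x)
        (oneF fun x => (starRingEnd ℂ) (α r.castSucc x)) v) :
    ∃ w : g, (∀ r : Fin m, α r.castSucc w = 0) ∧ α (Fin.last m) w = Complex.I ∧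
      ∀ (p : ℕ) (x : ExteriorAlgebra ℂ (CForm g)), ceD (fun X => ev p X x) =
        fun X => ev (p + 1) X (curvForm c (conjPair α) * innerProd w x) := by
  obtain ⟨w, hw⟩ := hbasis.2 (Fin.snoc (fun _ => 0) Complex.I)
  have hw0 (r : Fin m) : α r.castSucc w = 0 := by simpa using congrFun hw r.castSucc
  have hw1 : α (Fin.last m) w = Complex.I := by simpa using congrFun hw (Fin.last m)
  have hb0 (X Y : g) (r : Fin m) : α r.castSucc ⁅X, Y⁆ = 0 := by
    have h := congrFun (hd1 r) ![X, Y]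
    rw [ceD_oneF] at h
    simpa using h
  have hb1 (X Y : g) : α (Fin.last m) ⁅X, Y⁆ = -∑ r : Fin m, (c r : ℂ) *
      (α r.castSucc X * (starRingEnd ℂ) (α r.castSucc Y) -
        α r.castSucc Y * (starRingEnd ℂ) (α r.castSucc X)) := by
    have h := congrFun hd2 ![X, Y]
    simp only [ceD_oneF, wedge_oneF_oneF] at h
    rw [← h, neg_neg]
  have him (X Y : g) : α (Fin.last m) ⁅X, Y⁆ = ((α (Fin.last m) ⁅X, Y⁆).im : ℂ) * Complex.I := by
    have hre : (α (Fin.last m) ⁅X, Y⁆).re = 0 := by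
      rw [hb1, Complex.neg_re, Complex.re_sum, Finset.sum_eq_zero, neg_zero]
      intro r _
      simp [mul_comm]
    apply Complex.ext <;> simp [hre]
  refine ⟨w, hw0, hw1, fun p x => ceD_ev w _ (fun X Y => (α (Fin.last m) ⁅X, Y⁆).im) _ ?_
    (algebraMapInv_curvForm _ _) (innerProd_curvForm_mul _ _) ?_ x⟩
  · intro X Y
    apply hbasis.1
    funext i
    refine Fin.lastCases ?_ (fun r => ?_) i
    · simp only [map_smul, hw1]
      exact him X Y
    · simp [hb0, hw0]
  · intro X Y
    have h : ((α (Fin.last m) ⁅X, Y⁆).im : ℂ) = -Complex.I * α (Fin.last m) ⁅X, Y⁆ := by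
      linear_combination Complex.I * him X Y +
        ((α (Fin.last m) ⁅X, Y⁆).im : ℂ) * Complex.I_mul_I
    rw [h, hb1]
    simp only [LinearMap.smul_apply, LinearMap.sum_apply, LinearMap.sub_apply, conjPair_zero,
      conjPair_one_apply, smul_eq_mul]
    rw [mul_neg, neg_mul, neg_mul, neg_neg]
    simp only [mul_comm (starRingEnd ℂ _) _]

theorem lcb_of_structure_equations {k : ℕ} (α : Fin (k + 2) → CForm g) (c : Fin (k + 1) → ℝ)
    (hbasis : Function.Bijective (fun (x : g) (i : Fin (k + 2)) => α i x))
    (hcsum : (∑ r, c r) ≠ 0)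
    (hd1 : ∀ r : Fin (k + 1), ceD (oneF fun x => α r.castSucc x) = 0)
    (hd2 : ceD (oneF fun x => α (Fin.last (k + 1)) x) = fun v => ∑ r : Fin (k + 1), (c r : ℂ) *
      wedge (oneF fun x => α r.castSucc x)
        (oneF fun x => (starRingEnd ℂ) (α r.castSucc x)) v)
    (ω₁ : (Fin 2 → g) → ℂ)
    (hω₁ : ω₁ = fun v => Complex.I * ∑ i : Fin (k + 2),
      wedge (oneF fun x => α i x) (oneF fun x => (starRingEnd ℂ) (α i x)) v)
    (θ : (Fin 1 → g) → ℂ)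
    (hθ : θ = oneF fun x => ((∑ r, c r : ℝ) : ℂ) *
      (α (Fin.last (k + 1)) x + (starRingEnd ℂ) (α (Fin.last (k + 1)) x)))
    (h : 1 + 2 * (k + 1) = 2 * (k + 1) + 1) :
    ceD (wpow ω₁ (k + 1)) = reind h (wedge θ (wpow ω₁ (k + 1))) ∧ ceD θ = 0 ∧ θ ≠ 0 := by
  obtain ⟨w, hw0, hw1, hd⟩ := exists_ceD_ev_eq α c hbasis hd1 hd2
  set F := conjPair α with hF
  set u : CForm g := ((∑ r, c r : ℝ) : ℂ) • (F (Fin.last (k + 1)) 0 + F (Fin.last (k + 1)) 1)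
    with hu
  have hω : wpow ω₁ (k + 1) =
      fun X => ev (2 * (k + 1)) X ((Complex.I • ∑ i, pairForm F i) ^ (k + 1)) := by
    rw [hω₁]
    exact wpow_eq_ev F (k + 1)
  have hθu : θ = oneF fun x => u x := by
    rw [hθ]
    rfl
  have hFw (r : Fin (k + 1)) (s : Fin 2) : F r.castSucc s w = 0 := by
    fin_cases s
    · exact hw0 r
    · simp [hF, hw0]
  refine ⟨?_, ?_, ?_⟩
  · rw [hω, hd, hθu, wedge_oneF_pow,
      curvForm_mul_innerProd_pow c F w hFw hw1 (by simp [hF, hw1])]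
  · have hev : θ = fun X => ev 1 X (ExteriorAlgebra.ι ℂ u) := by
      funext X
      rw [hθu, ev_succ, innerProd_ι, ev_zero, ExteriorAlgebra.algebraMap_leftInverse]
      rfl
    have huw : u w = 0 := by simp [hu, hF, hw1]
    rw [hev, hd, innerProd_ι, huw, map_zero, mul_zero]
    funext X
    simp
  · intro h0
    obtain ⟨e, he⟩ := hbasis.2 fun _ => 1
    have he1 : α (Fin.last (k + 1)) e = 1 := congrFun he _
    have h1 := congrFun h0 fun _ => e
    rw [hθ] at h1
    simp only [oneF, he1, map_one, Pi.zero_apply, mul_eq_zero, Complex.ofReal_eq_zero, hcsum,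
      false_or] at h1
    norm_num at h1

theorem ceD_sum_mForm_eq_zero {m : ℕ} (α : Fin (m + 1) → CForm g) (c : Fin m → ℝ)
    (hbasis : Function.Bijective (fun (x : g) (i : Fin (m + 1)) => α i x))
    (hd1 : ∀ r : Fin m, ceD (oneF fun x => α r.castSucc x) = 0)
    (hd2 : ceD (oneF fun x => α (Fin.last m) x) = fun v => ∑ r : Fin m, (c r : ℂ) *
      wedge (oneF fun x => α r.castSucc x)
        (oneF fun x => (starRingEnd ℂ) (α r.castSucc x)) v)
    (a : Fin (m + 1) → ℝ) (ha : ∑ r : Fin m, a r.castSucc * c r = 0) (z : ℂ) :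
    ceD (fun X : Fin (2 * m) → g => z * ∑ i, (a i : ℂ) * mForm (m + 1) α i i X) = 0 := by
  obtain ⟨w, hw0, -, hd⟩ := exists_ceD_ev_eq α c hbasis hd1 hd2
  have hFw (r : Fin m) (s : Fin 2) : conjPair α r.castSucc s w = 0 := by
    fin_cases s
    · exact hw0 r
    · simp [hw0]
  have hev : (fun X : Fin (2 * m) → g => z * ∑ i, (a i : ℂ) * mForm (m + 1) α i i X) =
      fun X => ev (2 * m) X (z • ∑ i, (a i : ℂ) •
        (List.ofFn fun t : Fin m => pairForm (conjPair α) (i.succAbove t)).prod) := by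
    funext X
    simp only [mForm_eq_ev α (conjPair α) (fun _ => rfl) (fun _ _ => rfl), map_smul, map_sum,
      smul_eq_mul]
  rw [hev, hd, map_smul, mul_smul_comm,
    curvForm_mul_innerProd_sum c _ w hFw a ha, smul_zero]
  funext X
  simp

end ExteriorForms

/-- Let `n ≥ 3` and `𝔤` a `2n`-dimensional real `2`-step nilpotent Lie
algebra with complex structure `J`, coframe `α₁,…,α_n` of `(𝔤^{1,0})*` with `dαᵢ = 0`
(`i ≤ n−1`) and `dα_n = Σ_{r<n} c_r α_r ∧ ᾱ_r`, where `c_r > 0` for `r ≤ n−2`, `c_{n−1} < 0`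
and `Σ c_r ≠ 0`.  Then (a) `ω₁ = i Σ αᵢ ∧ ᾱᵢ` is locally conformally balanced with closed,
nonzero Lee form `θ = (Σ c_r)(α_n + ᾱ_n)`; and (b) for any positive `a₁,…,a_{n−2}, a_n` and
`a_{n−1} = −(Σ_{r≤n−2} a_r c_r)/c_{n−1}`, the `(n−1,n−1)`-form `ω̃ = i^{n−1} Σ aᵢ m_{i ī}`
is positive (`a_{n−1} > 0`) and closed, so `𝔤` also carries a balanced metric. -/
theorem statement17 (n : ℕ) (hn : 3 ≤ n)
    (g : Type) [LieRing g] [LieAlgebra ℝ g]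
    (h2step : ∀ x y z : g, ⁅⁅x, y⁆, z⁆ = 0)
    (J : g →ₗ[ℝ] g)
    (hJ2 : ∀ x, J (J x) = -x)
    (hJi : ∀ x y : g, J ⁅x, y⁆ - ⁅J x, y⁆ - ⁅x, J y⁆ - J ⁅J x, J y⁆ = 0)
    (α : Fin n → (g →ₗ[ℝ] ℂ))
    (hα10 : ∀ i x, α i (J x) = Complex.I * α i x)
    (hbasis : Function.Bijective (fun (x : g) (i : Fin n) => α i x))
    (c : Fin (n - 1) → ℝ)
    (hcpos : ∀ r : Fin (n - 1), (r : ℕ) < n - 2 → 0 < c r)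
    (hcneg : c ⟨n - 2, by omega⟩ < 0)
    (hcsum : (∑ r : Fin (n - 1), c r) ≠ 0)
    (hd1 : ∀ i : Fin n, (i : ℕ) < n - 1 → ceD (oneF fun x => α i x) = 0)
    (hd2 : ceD (oneF fun x => α ⟨n - 1, by omega⟩ x) =
      fun v => ∑ r : Fin (n - 1), (c r : ℂ) *
        wedge (oneF fun x => α (Fin.castLE (by omega) r) x)
          (oneF fun x => (starRingEnd ℂ) (α (Fin.castLE (by omega) r) x)) v)
    (ω₁ : (Fin 2 → g) → ℂ)
    (hω₁ : ω₁ = fun v => Complex.I * ∑ i : Fin n,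
      wedge (oneF fun x => α i x) (oneF fun x => (starRingEnd ℂ) (α i x)) v)
    (θ : (Fin 1 → g) → ℂ)
    (hθ : θ = oneF fun x => ((∑ r : Fin (n - 1), c r : ℝ) : ℂ) *
      (α ⟨n - 1, by omega⟩ x + (starRingEnd ℂ) (α ⟨n - 1, by omega⟩ x))) :
    (ceD (wpow ω₁ (n - 1)) = reind (by omega) (wedge θ (wpow ω₁ (n - 1))) ∧
     ceD θ = 0 ∧ θ ≠ 0) ∧
    (∀ a : Fin n → ℝ, (∀ i : Fin n, (i : ℕ) ≠ n - 2 → 0 < a i) →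
      a ⟨n - 2, by omega⟩ =
        -(∑ r : Fin (n - 1), if (r : ℕ) < n - 2
            then a (Fin.castLE (by omega) r) * c r else 0) / c ⟨n - 2, by omega⟩ →
      (0 < a ⟨n - 2, by omega⟩ ∧
       ceD (fun X : Fin (2 * n - 2) → g =>
         Complex.I ^ (n - 1) * ∑ i : Fin n, (a i : ℂ) * mForm n α i i X) = 0)) := by
  obtain ⟨k, rfl⟩ : ∃ k, n = k + 2 := ⟨n - 2, by omega⟩
  have hd1' (r : Fin (k + 1)) : ceD (oneF fun x => α r.castSucc x) = 0 := hd1 _ r.isLt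
  refine ⟨lcb_of_structure_equations α c hbasis hcsum hd1' hd2 ω₁ hω₁ θ hθ _, ?_⟩
  intro a hapos ha
  have hsplit (f : Fin (k + 1) → ℝ) :
      (∑ r : Fin (k + 1), if (r : ℕ) < k then f r else 0) + f (Fin.last k) = ∑ r, f r := by
    rw [Fin.sum_univ_castSucc, Fin.sum_univ_castSucc]
    simp
  have hneg : c (Fin.last k) < 0 := hcneg
  have ha' : a (Fin.last k).castSucc =
      -(∑ r : Fin (k + 1), if (r : ℕ) < k then a r.castSucc * c r else 0) / c (Fin.last k) := ha
  refine ⟨?_, ceD_sum_mForm_eq_zero α c hbasis hd1' hd2 a ?_ _⟩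
  · change 0 < a (Fin.last k).castSucc
    rw [ha']
    refine div_pos_of_neg_of_neg (neg_neg_of_pos (Finset.sum_pos' (fun r _ => ?_) ?_)) hneg
    · split_ifs with hr
      · exact (mul_pos (hapos _ (Nat.ne_of_lt hr)) (hcpos r hr)).le
      · exact le_rfl
    · have hk : 0 < k := by omega
      refine ⟨⟨0, by omega⟩, Finset.mem_univ _, ?_⟩
      rw [if_pos hk]
      exact mul_pos (hapos _ (Nat.ne_of_lt hk)) (hcpos _ hk)
  · rw [← hsplit, ha', div_mul_cancel₀ _ hneg.ne]
    ring
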